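/- Fix n ≥ 2 and work in the exterior-form model Σ := ⋀•(ℂ^{2n−1}) with ω := Σ_{p=1}^{n−1} y_{2p}∧y_{2p+1}. Let K := span_ℂ{ ψ_k : −1 ≤ k ≤ n−1 } where ψ_k := ω^{k+1} − i(k+1)·y₁∧ω^k. Then the set { Ψ ∈ K : c₁(Ψ) ∈ K } is a 2-dimensional complex subspace of K, equal to span_ℂ{ 1, y₁∧ω^{n−1} }. (In the 3-Sasakian setting, K is the space of invariant Killing spinors and this subspace is the invariant part of the bundle E₁⁻ = 𝓔₁ associated to the first Sasakian structure; note 1 = ψ_{−1} and y₁∧ω^{n−1} = (i/n)ψ_{n−1}.) -/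

import Mathlib

noncomputable section

/-- The underlying `(2n-1)`-dimensional complex vector space `ℂ^{2n-1}`. -/
abbrev ModelV (n : ℕ) : Type := Fin (2 * n - 1) → ℂ

/-- The exterior-form model `Σ = ⋀•(ℂ^{2n-1})` of the spinor module. -/
abbrev SpinorModel (n : ℕ) : Type := ExteriorAlgebra ℂ (ModelV n)

/-- The generator `y_{j+1}` (so `j` is the 0-based index), with junk value `0` out of range. -/
def yGen (n j : ℕ) : SpinorModel n :=
  if h : j < 2 * n - 1 then
    ExteriorAlgebra.ι ℂ (Pi.single (⟨j, h⟩ : Fin (2 * n - 1)) (1 : ℂ))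
  else 0

/-- Left exterior multiplication `y_{j+1} ∧ ·` (0-based index `j`). -/
def wdg (n j : ℕ) : SpinorModel n →ₗ[ℂ] SpinorModel n :=
  LinearMap.mulLeft ℂ (yGen n j)

/-- Contraction `x_{j+1} ⌟ ·` with the `(j+1)`-st dual basis vector (0-based index `j`),
with junk value `0` out of range. -/
def ctr (n j : ℕ) : SpinorModel n →ₗ[ℂ] SpinorModel n :=
  if h : j < 2 * n - 1 then
    CliffordAlgebra.contractLeft (LinearMap.proj (⟨j, h⟩ : Fin (2 * n - 1)))
  else 0

/-- The Clifford multiplication operators `c_a`, `1 ≤ a ≤ 4n-1`, of the exterior-form model: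
`c₁ = i·Id` on even degrees and `-i·Id` on odd degrees, `c_{2j} = i(x_j⌟ + y_j∧)` and
`c_{2j+1} = y_j∧ - x_j⌟` for `1 ≤ j ≤ 2n-1` (1-based indices). -/
def cop (n a : ℕ) : SpinorModel n →ₗ[ℂ] SpinorModel n :=
  if a = 1 then
    Complex.I • (CliffordAlgebra.involute : SpinorModel n →ₐ[ℂ] SpinorModel n).toLinearMap
  else if a % 2 = 0 then Complex.I • (ctr n (a / 2 - 1) + wdg n (a / 2 - 1))
  else wdg n (a / 2 - 1) - ctr n (a / 2 - 1)

/-- The invariant `2`-form `ω = ∑_{p=1}^{n-1} y_{2p} ∧ y_{2p+1}`. -/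
def om (n : ℕ) : SpinorModel n :=
  ∑ p ∈ Finset.Icc 1 (n - 1), yGen n (2 * p - 1) * yGen n (2 * p)

/-- The invariant Killing spinors `ψ_k = ω^{k+1} - i(k+1)·y₁∧ω^k`, reindexed by
`j = k + 1` (so `psi n j` is `ψ_{j-1}`, and `psi n 0 = ψ_{-1} = 1`). -/
def psi (n j : ℕ) : SpinorModel n :=
  om n ^ j - (Complex.I * (j : ℂ)) • (yGen n 0 * om n ^ (j - 1))

/-- The space of invariant spinors `Σ_inv = span_ℂ{ω^k, y₁∧ω^k : 0 ≤ k ≤ n-1}`. -/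
def Sinv (n : ℕ) : Submodule ℂ (SpinorModel n) :=
  Submodule.span ℂ {x | ∃ k ≤ n - 1, x = om n ^ k ∨ x = yGen n 0 * om n ^ k}

/-- The space of invariant Killing spinors `K = span_ℂ{ψ_k : -1 ≤ k ≤ n-1}`. -/
def KSpan (n : ℕ) : Submodule ℂ (SpinorModel n) :=
  Submodule.span ℂ {x | ∃ j ≤ n, x = psi n j}

open Polynomial in
/-- An element whose nilpotency index is exactly `n` is annihilated only by multiples of `X ^ n`. -/
theorem X_pow_dvd_of_aeval_eq_zero {A : Type*} [Ring A] [Algebra ℂ A] {a : A} {n : ℕ}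
    (hn : a ^ n = 0) (hn' : a ^ (n - 1) ≠ 0) {r : ℂ[X]} (hr : aeval a r = 0) : X ^ n ∣ r := by
  have h1 : minpoly ℂ a ∣ X ^ n := minpoly.dvd ℂ a (by simpa using hn)
  obtain ⟨k, hk, hassoc⟩ := (dvd_prime_pow prime_X n).1 h1
  have h2 : a ^ k = 0 := by
    have := (minpoly.dvd_iff (A := ℂ) (x := a) (p := X ^ k)).1 hassoc.dvd
    simpa using this
  have h3 : n ≤ k := by
    by_contra! hlt
    exact hn' (pow_eq_zero_of_le (by omega) h2)
  exact (pow_dvd_pow X h3).trans (hassoc.symm.dvd.trans (minpoly.dvd ℂ a hr))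

theorem Commute.add_pow_succ_of_mul_self_eq_zero {A : Type*} [Ring A] {a b : A}
    (hab : Commute a b) (hb : b * b = 0) (k : ℕ) :
    (a + b) ^ (k + 1) = a ^ (k + 1) + (k + 1 : ℕ) • (b * a ^ k) := by
  induction k with
  | zero => simp
  | succ k ih =>
    have h1 : b * a ^ k * a = b * a ^ (k + 1) := by rw [mul_assoc, pow_succ]
    have h2 : a ^ (k + 1) * b = b * a ^ (k + 1) := (hab.pow_left (k + 1)).eq
    have h3 : b * a ^ k * b = 0 := by
      rw [mul_assoc, (hab.pow_left k).eq, ← mul_assoc, hb, zero_mul]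
    rw [pow_succ, ih, add_mul, mul_add, smul_mul_assoc, mul_add, h1, h2, h3, ← pow_succ,
      succ_nsmul _ (k + 1), add_zero, add_assoc, add_comm (b * a ^ (k + 1))]

section Generators

variable (n : ℕ)

theorem yGen_mul_self (i : ℕ) : yGen n i * yGen n i = 0 := by
  unfold yGen
  split_ifs <;> simp

theorem yGen_mul_yGen (i j : ℕ) : yGen n i * yGen n j = -(yGen n j * yGen n i) := by
  unfold yGen
  split_ifs
  · exact eq_neg_of_add_eq_zero_left (ExteriorAlgebra.ι_add_mul_swap (R := ℂ) _ _)
  all_goals simp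

theorem commute_yGen_mul_yGen (i j k : ℕ) : Commute (yGen n i * yGen n j) (yGen n k) := by
  rw [commute_iff_eq, mul_assoc, yGen_mul_yGen n j k, mul_neg, ← mul_assoc, yGen_mul_yGen n i k,
    neg_mul, neg_neg, mul_assoc]

theorem yGen_mul_yGen_mul_self (i j : ℕ) :
    yGen n i * yGen n j * (yGen n i * yGen n j) = 0 := by
  rw [← mul_assoc, (commute_yGen_mul_yGen n i j i).eq, ← mul_assoc, yGen_mul_self, zero_mul,
    zero_mul]

theorem ctr_one (i : ℕ) : ctr n i 1 = 0 := by
  unfold ctr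
  split_ifs
  · exact CliffordAlgebra.contractLeft_one (Q := (0 : QuadraticForm ℂ (ModelV n))) _
  · rfl

theorem ctr_yGen_mul_self {i : ℕ} (hi : i < 2 * n - 1) (a : SpinorModel n) :
    ctr n i (yGen n i * a) = a - yGen n i * ctr n i a := by
  simp only [ctr, yGen, hi, dif_pos]
  erw [CliffordAlgebra.contractLeft_ι_mul]
  simp

theorem ctr_yGen_mul_of_ne {i j : ℕ} (hij : i ≠ j) (a : SpinorModel n) :
    ctr n i (yGen n j * a) = -(yGen n j * ctr n i a) := by
  unfold ctr yGen
  split_ifs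
  · erw [CliffordAlgebra.contractLeft_ι_mul]
    simp [hij]
  all_goals simp

theorem involute_yGen (i : ℕ) :
    (CliffordAlgebra.involute : SpinorModel n →ₐ[ℂ] SpinorModel n) (yGen n i) = -yGen n i := by
  unfold yGen
  split_ifs
  · exact CliffordAlgebra.involute_ι _
  · simp

/-- The partial sum `∑_{p=1}^{m} y_{2p} ∧ y_{2p+1}` of `ω`. -/
def omPartial (m : ℕ) : SpinorModel n :=
  ∑ p ∈ Finset.Icc 1 m, yGen n (2 * p - 1) * yGen n (2 * p)

theorem omPartial_succ (m : ℕ) :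
    omPartial n (m + 1) = omPartial n m + yGen n (2 * m + 1) * yGen n (2 * m + 2) := by
  rw [omPartial, Finset.sum_Icc_succ_top (by omega)]
  rfl

theorem ctr_omPartial_mul {i m : ℕ} (hi : i = 0 ∨ 2 * m < i) (a : SpinorModel n) :
    ctr n i (omPartial n m * a) = omPartial n m * ctr n i a := by
  simp only [omPartial, Finset.sum_mul, map_sum]
  refine Finset.sum_congr rfl fun p hp => ?_
  rw [Finset.mem_Icc] at hp
  rw [mul_assoc, ctr_yGen_mul_of_ne n (by omega), ctr_yGen_mul_of_ne n (by omega), mul_neg,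
    neg_neg, mul_assoc]

theorem ctr_omPartial_pow {i m : ℕ} (hi : i = 0 ∨ 2 * m < i) (k : ℕ) :
    ctr n i (omPartial n m ^ k) = 0 := by
  induction k with
  | zero => rw [pow_zero, ctr_one]
  | succ k ih => rw [pow_succ', ctr_omPartial_mul n hi, ih, mul_zero]

theorem omPartial_succ_pow (m k : ℕ) :
    omPartial n (m + 1) ^ (k + 1) = omPartial n m ^ (k + 1) +
      (k + 1 : ℕ) • (yGen n (2 * m + 1) * yGen n (2 * m + 2) * omPartial n m ^ k) := by
  rw [omPartial_succ]
  refine Commute.add_pow_succ_of_mul_self_eq_zero ?_ (yGen_mul_yGen_mul_self n _ _) k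
  exact Commute.sum_left _ _ _ fun p _ =>
    (commute_yGen_mul_yGen n _ _ _).mul_right (commute_yGen_mul_yGen n _ _ _)

theorem omPartial_pow_succ_eq_zero (m : ℕ) : omPartial n m ^ (m + 1) = 0 := by
  induction m with
  | zero => simp [omPartial]
  | succ m ih => rw [omPartial_succ_pow, pow_succ, ih, zero_mul, mul_zero, smul_zero, add_zero]

theorem omPartial_pow_self_ne_zero {m : ℕ} (hm : m < n) : omPartial n m ^ m ≠ 0 := by
  induction m with
  | zero => simp
  | succ m ih =>
    rw [omPartial_succ_pow, omPartial_pow_succ_eq_zero, zero_add]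
    intro h
    rw [← Nat.cast_smul_eq_nsmul ℂ] at h
    have h0 := (smul_eq_zero.1 h).resolve_left (Nat.cast_ne_zero.2 (Nat.succ_ne_zero m))
    have h1 := congrArg (fun x => ctr n (2 * m + 2) (ctr n (2 * m + 1) x)) h0
    simp only [mul_assoc, map_zero] at h1
    rw [ctr_yGen_mul_self n (by omega), ctr_yGen_mul_of_ne n (by omega),
      ctr_omPartial_pow n (by omega), mul_zero, neg_zero, mul_zero, sub_zero,
      ctr_yGen_mul_self n (by omega), ctr_omPartial_pow n (by omega), mul_zero, sub_zero] at h1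
    exact ih (by omega) h1

theorem involute_om :
    (CliffordAlgebra.involute : SpinorModel n →ₐ[ℂ] SpinorModel n) (om n) = om n := by
  simp [om, involute_yGen]

theorem om_pow_eq_zero (hn : 1 ≤ n) : om n ^ n = 0 := by
  have h := omPartial_pow_succ_eq_zero n (n - 1)
  rwa [Nat.sub_add_cancel hn] at h

theorem om_pow_pred_ne_zero (hn : 1 ≤ n) : om n ^ (n - 1) ≠ 0 :=
  omPartial_pow_self_ne_zero n (by omega)

end Generators

section Killing

open Polynomial

variable (n : ℕ)

/-- The spinor `p(ω) - i·y₁∧p'(ω)` attached to a polynomial `p`; it sends `X ^ j` to `ψ_{j-1}`. -/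
def polySpinor : ℂ[X] →ₗ[ℂ] SpinorModel n :=
  (aeval (om n)).toLinearMap -
    Complex.I • (wdg n 0 ∘ₗ (aeval (om n)).toLinearMap ∘ₗ derivative)

theorem polySpinor_apply (p : ℂ[X]) :
    polySpinor n p = aeval (om n) p - Complex.I • (yGen n 0 * aeval (om n) (derivative p)) := rfl

theorem polySpinor_X_pow (j : ℕ) : polySpinor n (X ^ j) = psi n j := by
  simp only [polySpinor_apply, psi, derivative_X_pow, map_mul, map_pow, aeval_X, aeval_C]
  rw [← Algebra.smul_def, mul_smul_comm, smul_smul]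

theorem KSpan_le_range_polySpinor : KSpan n ≤ LinearMap.range (polySpinor n) := by
  rw [KSpan, Submodule.span_le]
  rintro _ ⟨j, -, rfl⟩
  exact ⟨X ^ j, polySpinor_X_pow n j⟩

theorem psi_mem_KSpan {j : ℕ} (hj : j ≤ n) : psi n j ∈ KSpan n :=
  Submodule.subset_span ⟨j, hj, rfl⟩

theorem ctr_zero_aeval_om (p : ℂ[X]) : ctr n 0 (aeval (om n) p) = 0 := by
  induction p using Polynomial.induction_on' with
  | add p q hp hq => rw [map_add, map_add, hp, hq, add_zero]
  | monomial k c =>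
    rw [aeval_monomial, ← Algebra.smul_def, map_smul]
    exact (congrArg (c • ·) (ctr_omPartial_pow n (Or.inl rfl) k)).trans (smul_zero c)

theorem ctr_zero_yGen_mul_aeval_om (hn : 1 ≤ n) (p : ℂ[X]) :
    ctr n 0 (yGen n 0 * aeval (om n) p) = aeval (om n) p := by
  rw [ctr_yGen_mul_self n (by omega), ctr_zero_aeval_om, mul_zero, sub_zero]

theorem involute_aeval_om (p : ℂ[X]) :
    (CliffordAlgebra.involute : SpinorModel n →ₐ[ℂ] SpinorModel n) (aeval (om n) p) =
      aeval (om n) p := by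
  rw [← aeval_algHom_apply, involute_om]

theorem cop_one_apply (a : SpinorModel n) :
    cop n 1 a =
      Complex.I • (CliffordAlgebra.involute : SpinorModel n →ₐ[ℂ] SpinorModel n) a := by
  simp [cop]

theorem cop_one_aeval_om (p : ℂ[X]) :
    cop n 1 (aeval (om n) p) = Complex.I • aeval (om n) p := by
  rw [cop_one_apply, involute_aeval_om]

theorem cop_one_yGen_mul_aeval_om (p : ℂ[X]) :
    cop n 1 (yGen n 0 * aeval (om n) p) = -Complex.I • (yGen n 0 * aeval (om n) p) := by
  rw [cop_one_apply, map_mul, involute_aeval_om, involute_yGen, neg_mul, smul_neg, neg_smul]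

/-- If `c₁` maps the spinor of `p` to the spinor of `q`, then `p'` vanishes to order `n - 1`. -/
theorem X_pow_dvd_derivative_of_cop_one_eq (hn : 1 ≤ n) {p q : ℂ[X]}
    (h : cop n 1 (polySpinor n p) = polySpinor n q) : X ^ (n - 1) ∣ derivative p := by
  rw [polySpinor_apply, polySpinor_apply, map_sub, map_smul, cop_one_aeval_om,
    cop_one_yGen_mul_aeval_om] at h
  have hodd := congrArg (ctr n 0) h
  simp only [map_sub, map_smul, ctr_zero_yGen_mul_aeval_om n hn, ctr_zero_aeval_om, smul_zero,
    zero_sub, smul_smul, neg_inj] at hodd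
  have hodd' : aeval (om n) (derivative q) =
      aeval (om n) (-(C Complex.I * derivative p)) := by
    have h1 := congrArg (fun x => (-Complex.I) • x) hodd
    simp only [smul_smul] at h1
    have e1 : -Complex.I * (Complex.I * -Complex.I) = -Complex.I := by
      linear_combination Complex.I * Complex.I_mul_I
    have e2 : -Complex.I * Complex.I = 1 := by linear_combination -Complex.I_mul_I
    rw [e1, e2, one_smul] at h1
    rw [← h1, map_neg, map_mul, aeval_C, ← Algebra.smul_def, neg_smul]
  have heven : aeval (om n) q = aeval (om n) (C Complex.I * p) := by
    rw [hodd', map_neg, map_mul, aeval_C, ← Algebra.smul_def, mul_neg, mul_smul_comm,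
      smul_neg, smul_smul, smul_smul, mul_neg, neg_smul] at h
    rw [map_mul, aeval_C, ← Algebra.smul_def]
    exact (sub_left_inj.1 h).symm
  have d1 : X ^ n ∣ q - C Complex.I * p :=
    X_pow_dvd_of_aeval_eq_zero (om_pow_eq_zero n hn) (om_pow_pred_ne_zero n hn)
      (by rw [map_sub, heven, sub_self])
  have d2 : X ^ n ∣ derivative q - -(C Complex.I * derivative p) :=
    X_pow_dvd_of_aeval_eq_zero (om_pow_eq_zero n hn) (om_pow_pred_ne_zero n hn)
      (by rw [map_sub, hodd', sub_self])
  have d3 : X ^ (n - 1) ∣ derivative (q - C Complex.I * p) :=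
    pow_sub_one_dvd_derivative_of_pow_dvd d1
  rw [derivative_sub, derivative_C_mul] at d3
  have d4 := dvd_sub ((pow_dvd_pow X (Nat.sub_le n 1)).trans d2) d3
  have e : derivative q - -(C Complex.I * derivative p) -
      (derivative q - C Complex.I * derivative p) = C (2 * Complex.I) * derivative p := by
    rw [C_mul, show (C (2 : ℂ)) = 2 from rfl]
    ring
  rw [e] at d4
  exact (IsUnit.dvd_mul_left (isUnit_C.2 (by simp))).1 d4

theorem polySpinor_mem_span (hn : 1 ≤ n) {p : ℂ[X]} (hp : X ^ (n - 1) ∣ derivative p) :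
    polySpinor n p ∈ Submodule.span ℂ {(1 : SpinorModel n), yGen n 0 * om n ^ (n - 1)} := by
  have hp0 : X ^ n ∣ p - C (p.coeff 0) := by
    rw [X_pow_dvd_iff] at hp ⊢
    intro d hd
    rcases d with _ | d
    · rw [coeff_sub, coeff_C_zero, sub_self]
    · have h := hp d (by omega)
      rw [coeff_derivative] at h
      have : p.coeff (d + 1) = 0 :=
        (mul_eq_zero.1 h).resolve_right (by exact_mod_cast Nat.succ_ne_zero d)
      simp [this]
  have heven : aeval (om n) p = p.coeff 0 • 1 := by
    obtain ⟨s, hs⟩ := hp0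
    have h := congrArg (aeval (om n)) hs
    rw [map_sub, map_mul, map_pow, aeval_X, om_pow_eq_zero n hn, zero_mul, aeval_C] at h
    rw [sub_eq_zero.1 h, Algebra.algebraMap_eq_smul_one]
  obtain ⟨s, hs⟩ := hp
  have hodd : aeval (om n) (derivative p) = s.coeff 0 • om n ^ (n - 1) := by
    obtain ⟨t, ht⟩ : X ∣ s - C (s.coeff 0) := X_dvd_iff.2 (by simp)
    rw [hs, eq_add_of_sub_eq ht, mul_add, ← mul_assoc, ← pow_succ, Nat.sub_add_cancel hn]
    simp [om_pow_eq_zero n hn, ← Algebra.smul_def]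
  rw [polySpinor_apply, heven, hodd, mul_smul_comm]
  exact sub_mem (Submodule.smul_mem _ _ (Submodule.subset_span (by simp)))
    (Submodule.smul_mem _ _ (Submodule.smul_mem _ _ (Submodule.subset_span (by simp))))

theorem one_mem_KSpan : (1 : SpinorModel n) ∈ KSpan n := by
  simpa [psi] using psi_mem_KSpan n (Nat.zero_le n)

theorem yGen_mul_om_pow_mem_KSpan (hn : 1 ≤ n) : yGen n 0 * om n ^ (n - 1) ∈ KSpan n := by
  have h := psi_mem_KSpan n le_rfl
  rw [psi, om_pow_eq_zero n hn, zero_sub] at h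
  exact ((KSpan n).smul_mem_iff (mul_ne_zero Complex.I_ne_zero
    (Nat.cast_ne_zero.2 (by omega)))).1 (neg_mem_iff.1 h)

end Killing

/-- For `n ≥ 2`, within the space `K = span_ℂ{ψ_k : -1 ≤ k ≤ n-1}` of
invariant Killing spinors, the set `{Ψ ∈ K : c₁(Ψ) ∈ K}` is a 2-dimensional complex
subspace of `K`, equal to `span_ℂ{1, y₁∧ω^{n-1}}`. -/
theorem E1_invariant_part (n : ℕ) (hn : 2 ≤ n) :
    {Ψ : SpinorModel n | Ψ ∈ KSpan n ∧ cop n 1 Ψ ∈ KSpan n} =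
      (Submodule.span ℂ {(1 : SpinorModel n), yGen n 0 * om n ^ (n - 1)} :
        Submodule ℂ (SpinorModel n)) ∧
    Module.finrank ℂ
      (Submodule.span ℂ {(1 : SpinorModel n), yGen n 0 * om n ^ (n - 1)}) = 2 := by
  have hn1 : 1 ≤ n := by omega
  have hone : cop n 1 1 = Complex.I • 1 := by rw [cop_one_apply, map_one]
  have htop : cop n 1 (yGen n 0 * om n ^ (n - 1)) =
      -Complex.I • (yGen n 0 * om n ^ (n - 1)) := by
    simpa using cop_one_yGen_mul_aeval_om n (Polynomial.X ^ (n - 1))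
  constructor
  · apply Set.Subset.antisymm
    · rintro Ψ ⟨hΨ, hcΨ⟩
      obtain ⟨p, rfl⟩ := KSpan_le_range_polySpinor n hΨ
      obtain ⟨q, hq⟩ := KSpan_le_range_polySpinor n hcΨ
      exact polySpinor_mem_span n hn1 (X_pow_dvd_derivative_of_cop_one_eq n hn1 hq.symm)
    · change Submodule.span ℂ _ ≤ KSpan n ⊓ (KSpan n).comap (cop n 1)
      rw [Submodule.span_le]
      rintro _ (rfl | rfl)
      · refine ⟨one_mem_KSpan n, ?_⟩
        change cop n 1 1 ∈ KSpan n
        rw [hone]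
        exact (KSpan n).smul_mem _ (one_mem_KSpan n)
      · refine ⟨yGen_mul_om_pow_mem_KSpan n hn1, ?_⟩
        change cop n 1 _ ∈ KSpan n
        rw [htop]
        exact (KSpan n).smul_mem _ (yGen_mul_om_pow_mem_KSpan n hn1)
  · have hli : LinearIndependent ℂ ![(1 : SpinorModel n), yGen n 0 * om n ^ (n - 1)] := by
      rw [LinearIndependent.pair_iff]
      intro s t hst
      have hctr := congrArg (ctr n 0) hst
      have h1 : ctr n 0 (yGen n 0 * om n ^ (n - 1)) = om n ^ (n - 1) := by
        simpa using ctr_zero_yGen_mul_aeval_om n hn1 (Polynomial.X ^ (n - 1))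
      rw [map_add, map_smul, map_smul, ctr_one, h1, smul_zero, zero_add, map_zero] at hctr
      have ht : t = 0 := (smul_eq_zero.1 hctr).resolve_right (om_pow_pred_ne_zero n hn1)
      rw [ht, zero_smul, add_zero] at hst
      exact ⟨(smul_eq_zero.1 hst).resolve_right one_ne_zero, ht⟩
    have h := finrank_span_eq_card hli
    rwa [Matrix.range_cons_cons_empty, Fintype.card_fin] at h
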